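/- Let q ∈ L¹(0,π) be real-valued and let f be a rational Herglotz–Nevanlinna function. Let μ < ν be two eigenvalues of P(q,f,∞) such that no eigenvalue of P(q,f,∞) lies in the open interval (μ,ν) and no pole of f lies in the closed interval [μ,ν], and let b ∈ ℝ. Then there exists exactly one eigenvalue of P(q,f,b) in the open interval (μ,ν). -/

import Mathlib

open MeasureTheory Set

noncomputable section

/-- A rational Herglotz–Nevanlinna function, given by its canonical data:
`f(λ) = a·λ + c + Σ_j γ_j / (β_j − λ)` with `a ≥ 0`, `γ_j > 0` and `β_1 < … < β_n`. -/
structure RatHN where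
  a : ℝ
  c : ℝ
  n : ℕ
  γ : Fin n → ℝ
  β : Fin n → ℝ
  ha : 0 ≤ a
  hγ : ∀ j, 0 < γ j
  hβ : StrictMono β

namespace RatHN

/-- The value `f(λ)` of a rational Herglotz–Nevanlinna function. -/
def eval (f : RatHN) (lam : ℝ) : ℝ :=
  f.a * lam + f.c + ∑ j : Fin f.n, f.γ j / (f.β j - lam)

/-- `lam` is a pole of `f`. -/
def IsPole (f : RatHN) (lam : ℝ) : Prop := ∃ j, f.β j = lam

end RatHN

/-- A (Carathéodory) solution of `−y″ + Q·y = λ·y` on `[0, L]`: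
a pair of continuous functions `y, y'` satisfying the two integral equations. -/
def IsCaraSol (Q : ℝ → ℝ) (L lam : ℝ) (y y' : ℝ → ℝ) : Prop :=
  ContinuousOn y (Icc 0 L) ∧ ContinuousOn y' (Icc 0 L) ∧
  (∀ x ∈ Icc (0:ℝ) L, y x = y 0 + ∫ t in (0:ℝ)..x, y' t) ∧
  (∀ x ∈ Icc (0:ℝ) L, y' x = y' 0 + ∫ t in (0:ℝ)..x, (Q t - lam) * y t)

/-- `lam` is an eigenvalue of the problem `P(q, f, b)`, where `b : Option ℝ`
and `none` stands for the Dirichlet condition (`b = ∞`) at the right endpoint. -/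
def IsEigen (q : ℝ → ℝ) (f : RatHN) (b : Option ℝ) (lam : ℝ) : Prop :=
  ∃ y y' : ℝ → ℝ, IsCaraSol q Real.pi lam y y' ∧
    (∃ x ∈ Icc (0:ℝ) Real.pi, y x ≠ 0) ∧
    (¬ f.IsPole lam → y' 0 = -f.eval lam * y 0) ∧
    (f.IsPole lam → y 0 = 0) ∧
    (∀ bb : ℝ, b = some bb → y' Real.pi = bb * y Real.pi) ∧
    (b = none → y Real.pi = 0)

/-- The set of eigenvalues of the problem `P(q, f, b)`. -/
def eigenvalues (q : ℝ → ℝ) (f : RatHN) (b : Option ℝ) : Set ℝ :=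
  {lam | IsEigen q f b lam}

/-- `Λ` is an enumeration of the set `S`: a strictly increasing sequence whose
range is exactly `S`. -/
def IsEnum (S : Set ℝ) (Λ : ℕ → ℝ) : Prop :=
  StrictMono Λ ∧ Set.range Λ = S

open Filter Topology

/-- Product rule for primitives of integrable functions. -/
theorem integral_deriv_mul_add_of_primitive {L : ℝ} (hL : 0 ≤ L) {F G f g : ℝ → ℝ}
    (hf : IntervalIntegrable f volume 0 L) (hg : IntervalIntegrable g volume 0 L)
    (hF : ∀ x ∈ Icc 0 L, F x = F 0 + ∫ t in (0:ℝ)..x, f t)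
    (hG : ∀ x ∈ Icc 0 L, G x = G 0 + ∫ t in (0:ℝ)..x, g t) :
    ∫ t in (0:ℝ)..L, (f t * G t + F t * g t) = F L * G L - F 0 * G 0 := by
  have h0 : (0:ℝ) ∈ uIcc 0 L := left_mem_uIcc
  have hac : ∀ (c : ℝ) {h : ℝ → ℝ}, IntervalIntegrable h volume 0 L →
      AbsolutelyContinuousOnInterval (fun x => c + ∫ t in (0:ℝ)..x, h t) 0 L := fun c h hh =>
    (((LipschitzWith.const c).lipschitzOnWith).absolutelyContinuousOnInterval).add
      (hh.absolutelyContinuousOnInterval_intervalIntegral h0)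
  have key := (hac (F 0) hf).integral_deriv_mul_eq_sub (hac (G 0) hg)
  simp only [intervalIntegral.integral_same, add_zero] at key
  rw [← hF L ⟨hL, le_rfl⟩, ← hG L ⟨hL, le_rfl⟩] at key
  rw [← key]
  apply intervalIntegral.integral_congr_ae
  filter_upwards [hf.ae_hasDerivAt_integral, hg.ae_hasDerivAt_integral] with x hx1 hx2 hx
  have hx' := uIoc_subset_uIcc hx
  rw [((hx1 hx' 0 h0).const_add (F 0)).deriv, ((hx2 hx' 0 h0).const_add (G 0)).deriv]
  rw [uIcc_of_le hL] at hx'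
  rw [hF x hx', hG x hx']

/-- Powers of a primitive are themselves primitives. -/
theorem pow_succ_primitive_eq_integral {L : ℝ} {g : ℝ → ℝ}
    (hg : IntervalIntegrable g volume 0 L) (n : ℕ) :
    ∀ x ∈ Icc 0 L, (∫ t in (0:ℝ)..x, g t) ^ (n + 1) =
      ∫ t in (0:ℝ)..x, (n + 1) * (g t * (∫ s in (0:ℝ)..t, g s) ^ n) := by
  have hsub : ∀ x ∈ Icc 0 L, IntervalIntegrable g volume 0 x := fun x hx =>
    hg.mono_set (by rw [uIcc_of_le hx.1, uIcc_of_le (hx.1.trans hx.2)]; exact Icc_subset_Icc_right hx.2)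
  have hint : ∀ (m : ℕ), ∀ x ∈ Icc 0 L, IntervalIntegrable
      (fun t => (m + 1) * (g t * (∫ s in (0:ℝ)..t, g s) ^ m)) volume 0 x := fun m x hx =>
    ((hsub x hx).mul_continuousOn
      ((intervalIntegral.continuousOn_primitive_interval' (hsub x hx) left_mem_uIcc).pow m)).const_mul _
  induction n with
  | zero => intro x _; simp
  | succ n ih =>
    intro x hx
    have key := integral_deriv_mul_add_of_primitive hx.1 (F := fun x => ∫ t in (0:ℝ)..x, g t)
      (G := fun x => (∫ t in (0:ℝ)..x, g t) ^ (n + 1)) (hsub x hx) (hint n x hx)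
      (fun y _ => by simp) (fun y hy => by simpa using ih y ⟨hy.1, hy.2.trans hx.2⟩)
    simp only [intervalIntegral.integral_same, zero_mul, sub_zero] at key
    rw [pow_succ', ← key]
    congr 1
    ext t
    push_cast
    ring

section Volterra

variable {F : Type*} [NormedAddCommGroup F] [NormedSpace ℝ F] {L : ℝ}

theorem intervalIntegrable_clm_apply (A : ℝ → F →L[ℝ] F)
    (hA : IntervalIntegrable A volume 0 L) {v : ℝ → F} (hv : Continuous v) {x : ℝ}
    (hx : x ∈ Icc 0 L) : IntervalIntegrable (fun t => A t (v t)) volume 0 x := by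
  have hA' : IntervalIntegrable A volume 0 x := hA.mono_set
    (by rw [uIcc_of_le hx.1, uIcc_of_le (hx.1.trans hx.2)]; exact Icc_subset_Icc_right hx.2)
  obtain ⟨C, hC⟩ := isCompact_uIcc.exists_bound_of_continuousOn (s := uIcc 0 x) hv.continuousOn
  refine (hA'.norm.mul_const C).mono_fun' ?_ ?_
  · exact isBoundedBilinearMap_apply.continuous.comp_aestronglyMeasurable
      (hA'.aestronglyMeasurable_restrict_uIoc.prodMk hv.aestronglyMeasurable)
  · filter_upwards [ae_restrict_mem measurableSet_uIoc] with t ht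
    exact (A t).le_of_opNorm_le_of_le le_rfl (hC t (uIoc_subset_uIcc ht))

/-- The Volterra operator `u ↦ ∫₀ˣ A(t) u(t) dt` on the continuous functions on `[0, L]`. -/
def volterra (hL : 0 ≤ L) (A : ℝ → F →L[ℝ] F) (hA : IntervalIntegrable A volume 0 L) :
    C(Icc 0 L, F) →L[ℝ] C(Icc 0 L, F) :=
  have hint (u : C(Icc 0 L, F)) {x : ℝ} (hx : x ∈ Icc 0 L) :
      IntervalIntegrable (fun t => A t (u (projIcc 0 L hL t))) volume 0 x :=
    intervalIntegrable_clm_apply A hA (by fun_prop) hx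
  LinearMap.mkContinuous
    { toFun u := ⟨fun x => ∫ t in (0:ℝ)..x, A t (u (projIcc 0 L hL t)), by
        have := intervalIntegral.continuousOn_primitive_interval'
          (hint u (right_mem_Icc.2 hL)) left_mem_uIcc
        rw [uIcc_of_le hL] at this
        exact this.domRestrict⟩
      map_add' u v := by
        ext x
        simp only [ContinuousMap.add_apply, map_add, ContinuousMap.coe_mk]
        exact intervalIntegral.integral_add (hint u x.2) (hint v x.2)
      map_smul' c u := by
        ext x
        simp only [ContinuousMap.smul_apply, map_smul, ContinuousMap.coe_mk, RingHom.id_apply]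
        exact intervalIntegral.integral_smul c _ }
    (∫ t in (0:ℝ)..L, ‖A t‖) (fun u => by
      have h0 : 0 ≤ ∫ t in (0:ℝ)..L, ‖A t‖ :=
        intervalIntegral.integral_nonneg hL fun _ _ => norm_nonneg _
      rw [ContinuousMap.norm_le _ (by positivity)]
      intro x
      have hA' : IntervalIntegrable A volume 0 x := hA.mono_set
        (by rw [uIcc_of_le x.2.1, uIcc_of_le hL]; exact Icc_subset_Icc_right x.2.2)
      calc ‖∫ t in (0:ℝ)..x, A t (u (projIcc 0 L hL t))‖
          ≤ ∫ t in (0:ℝ)..x, ‖A t‖ * ‖u‖ :=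
            intervalIntegral.norm_integral_le_of_norm_le x.2.1
              (Eventually.of_forall fun t _ =>
                (A t).le_of_opNorm_le_of_le le_rfl (u.norm_coe_le_norm _))
              (hA'.norm.mul_const _)
        _ = (∫ t in (0:ℝ)..x, ‖A t‖) * ‖u‖ := by simp
        _ ≤ (∫ t in (0:ℝ)..L, ‖A t‖) * ‖u‖ := by
            gcongr
            exact intervalIntegral.integral_mono_interval le_rfl x.2.1 x.2.2
              (Eventually.of_forall fun _ => norm_nonneg _) hA.norm)

theorem volterra_apply (hL : 0 ≤ L) (A : ℝ → F →L[ℝ] F) (hA : IntervalIntegrable A volume 0 L)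
    (u : C(Icc 0 L, F)) (x : Icc 0 L) :
    volterra hL A hA u x = ∫ t in (0:ℝ)..x, A t (u (projIcc 0 L hL t)) := rfl

theorem norm_volterra_pow_apply_le (hL : 0 ≤ L) (A : ℝ → F →L[ℝ] F)
    (hA : IntervalIntegrable A volume 0 L) (n : ℕ) (u : C(Icc 0 L, F)) (x : Icc 0 L) :
    ‖(volterra hL A hA ^ n) u x‖ ≤ (∫ t in (0:ℝ)..x, ‖A t‖) ^ n / n.factorial * ‖u‖ := by
  induction n generalizing x with
  | zero => simpa using u.norm_coe_le_norm x
  | succ n ih =>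
    have hA' : IntervalIntegrable A volume 0 x := hA.mono_set
      (by rw [uIcc_of_le x.2.1, uIcc_of_le hL]; exact Icc_subset_Icc_right x.2.2)
    rw [pow_succ', mul_apply_eq_comp, volterra_apply]
    calc _ ≤ ∫ t in (0:ℝ)..x, (n + 1) * (‖A t‖ * (∫ s in (0:ℝ)..t, ‖A s‖) ^ n) *
          (((n + 1).factorial : ℝ)⁻¹ * ‖u‖) := by
            refine intervalIntegral.norm_integral_le_of_norm_le x.2.1
              (Eventually.of_forall fun t ht => ?_) ?_
            · have ht' : t ∈ Icc 0 L := ⟨ht.1.le, ht.2.trans x.2.2⟩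
              have := ih (projIcc 0 L hL t)
              refine ((A t).le_of_opNorm_le_of_le le_rfl this).trans_eq ?_
              rw [projIcc_of_mem hL ht', Nat.factorial_succ]
              push_cast
              field_simp
            · exact (((hA'.norm).mul_continuousOn
                ((intervalIntegral.continuousOn_primitive_interval' hA'.norm
                  left_mem_uIcc).pow n)).const_mul _).mul_const _
      _ = _ := by
            rw [intervalIntegral.integral_mul_const,
              ← pow_succ_primitive_eq_integral hA.norm n x x.2]
            ring

theorem isUnit_one_sub_volterra (hL : 0 ≤ L) [CompleteSpace F] (A : ℝ → F →L[ℝ] F)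
    (hA : IntervalIntegrable A volume 0 L) : IsUnit (1 - volterra hL A hA) := by
  obtain ⟨n, hn⟩ := ((FloorSemiring.tendsto_pow_div_factorial_atTop
    (∫ t in (0:ℝ)..L, ‖A t‖)).eventually_lt_const one_pos).exists
  have h0 : 0 ≤ ∫ t in (0:ℝ)..L, ‖A t‖ :=
    intervalIntegral.integral_nonneg hL fun _ _ => norm_nonneg _
  have hnorm : ‖volterra hL A hA ^ n‖ < 1 := by
    refine lt_of_le_of_lt (ContinuousLinearMap.opNorm_le_bound _ (by positivity) fun u => ?_) hn
    rw [ContinuousMap.norm_le _ (by positivity)]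
    intro x
    refine (norm_volterra_pow_apply_le hL A hA n u x).trans ?_
    have h0' : 0 ≤ ∫ t in (0:ℝ)..x, ‖A t‖ :=
      intervalIntegral.integral_nonneg x.2.1 fun _ _ => norm_nonneg _
    gcongr
    exact intervalIntegral.integral_mono_interval le_rfl x.2.1 x.2.2
      (Eventually.of_forall fun _ => norm_nonneg _) hA.norm
  have hu := isUnit_one_sub_of_norm_lt_one (R := C(Icc 0 L, F) →L[ℝ] C(Icc 0 L, F)) hnorm
  rw [← mul_neg_geom_sum] at hu
  refine ((Commute.isUnit_mul_iff ?_).1 hu).1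
  exact (mul_neg_geom_sum _ _).trans (geom_sum_mul_neg _ _).symm

end Volterra

section InitialValueProblem

variable {L : ℝ} {q : ℝ → ℝ}

/-- The coefficient matrix of `−y″ + q·y = λ·y` written as a first order system. -/
def systemCoeff (q : ℝ → ℝ) (lam t : ℝ) : ℝ × ℝ →L[ℝ] ℝ × ℝ :=
  (ContinuousLinearMap.inl ℝ ℝ ℝ ∘L ContinuousLinearMap.snd ℝ ℝ ℝ) +
    (q t - lam) • (ContinuousLinearMap.inr ℝ ℝ ℝ ∘L ContinuousLinearMap.fst ℝ ℝ ℝ)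

theorem systemCoeff_apply (lam t : ℝ) (v : ℝ × ℝ) :
    systemCoeff q lam t v = (v.2, (q t - lam) * v.1) := by
  simp [systemCoeff]

theorem intervalIntegrable_systemCoeff (hq : IntervalIntegrable q volume 0 L) (lam : ℝ) :
    IntervalIntegrable (systemCoeff q lam) volume 0 L := by
  have h1 : IntervalIntegrable (fun t => q t - lam) volume 0 L := hq.sub intervalIntegrable_const
  have h2 : IntervalIntegrable (fun t => (q t - lam) •
      (ContinuousLinearMap.inr ℝ ℝ ℝ ∘L ContinuousLinearMap.fst ℝ ℝ ℝ)) volume 0 L :=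
    ⟨h1.1.smul_const _, h1.2.smul_const _⟩
  exact IntervalIntegrable.add intervalIntegrable_const h2

/-- The Volterra operator of the first order system. -/
def systemVolterra (hL : 0 ≤ L) (hq : IntervalIntegrable q volume 0 L) (lam : ℝ) :
    C(Icc 0 L, ℝ × ℝ) →L[ℝ] C(Icc 0 L, ℝ × ℝ) :=
  volterra hL (systemCoeff q lam) (intervalIntegrable_systemCoeff hq lam)

theorem intervalIntegrable_systemCoeff_apply (hL : 0 ≤ L) (hq : IntervalIntegrable q volume 0 L)
    (lam : ℝ) (u : C(Icc 0 L, ℝ × ℝ)) (x : Icc 0 L) :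
    IntervalIntegrable (fun t => systemCoeff q lam t (u (projIcc 0 L hL t))) volume 0 x :=
  intervalIntegrable_clm_apply _ (intervalIntegrable_systemCoeff hq lam)
    (v := fun t => u (projIcc 0 L hL t)) (by fun_prop) x.2

theorem systemVolterra_apply (hL : 0 ≤ L) (hq : IntervalIntegrable q volume 0 L) (lam : ℝ)
    (u : C(Icc 0 L, ℝ × ℝ)) (x : Icc 0 L) :
    systemVolterra hL hq lam u x =
      (∫ t in (0:ℝ)..x, (u (projIcc 0 L hL t)).2,
        ∫ t in (0:ℝ)..x, (q t - lam) * (u (projIcc 0 L hL t)).1) := by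
  have hi := intervalIntegrable_systemCoeff_apply hL hq lam u x
  rw [systemVolterra, volterra_apply]
  ext
  · have := (ContinuousLinearMap.fst ℝ ℝ ℝ).intervalIntegral_comp_comm hi
    simpa [systemCoeff_apply] using this.symm
  · have := (ContinuousLinearMap.snd ℝ ℝ ℝ).intervalIntegral_comp_comm hi
    simpa [systemCoeff_apply] using this.symm

theorem continuous_systemVolterra (hL : 0 ≤ L) (hq : IntervalIntegrable q volume 0 L) :
    Continuous (systemVolterra hL hq) := by
  have h : systemVolterra hL hq = fun lam => systemVolterra hL hq 0 - lam •
      volterra hL (fun _ => ContinuousLinearMap.inr ℝ ℝ ℝ ∘L ContinuousLinearMap.fst ℝ ℝ ℝ)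
        intervalIntegrable_const := by
    ext1 lam
    ext1 u
    ext1 x
    rw [sub_apply, ContinuousMap.sub_apply, smul_apply,
      ContinuousMap.smul_apply, systemVolterra, systemVolterra, volterra_apply, volterra_apply,
      volterra_apply, ← intervalIntegral.integral_smul, ← intervalIntegral.integral_sub]
    · congr 1
      ext t <;> simp [systemCoeff_apply]
      ring
    · exact intervalIntegrable_systemCoeff_apply hL hq 0 u x
    · exact Continuous.intervalIntegrable (by fun_prop) _ _
  rw [h]
  fun_prop

/-- The solution of the first order system with initial value `w`. -/
def systemSol (hL : 0 ≤ L) (hq : IntervalIntegrable q volume 0 L) (lam : ℝ) (w : ℝ × ℝ) :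
    C(Icc 0 L, ℝ × ℝ) :=
  Ring.inverse (1 - systemVolterra hL hq lam) (ContinuousMap.const _ w)

theorem isUnit_one_sub_systemVolterra (hL : 0 ≤ L) (hq : IntervalIntegrable q volume 0 L)
    (lam : ℝ) : IsUnit (1 - systemVolterra hL hq lam) :=
  isUnit_one_sub_volterra hL _ _

theorem eq_systemSol_iff (hL : 0 ≤ L) (hq : IntervalIntegrable q volume 0 L) (lam : ℝ)
    (w : ℝ × ℝ) (u : C(Icc 0 L, ℝ × ℝ)) :
    u = systemSol hL hq lam w ↔ u - systemVolterra hL hq lam u = ContinuousMap.const _ w := by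
  have hu := isUnit_one_sub_systemVolterra hL hq lam
  constructor
  · rintro rfl
    have := DFunLike.congr_fun (Ring.mul_inverse_cancel _ hu) (ContinuousMap.const _ w)
    simpa [systemSol] using this
  · intro h
    have := DFunLike.congr_fun (Ring.inverse_mul_cancel _ hu) u
    rw [systemSol, ← h]
    simpa using this.symm

theorem continuousAt_systemSol (hL : 0 ≤ L) (hq : IntervalIntegrable q volume 0 L) {w : ℝ → ℝ × ℝ}
    {lam : ℝ} (hw : ContinuousAt w lam) :
    ContinuousAt (fun l => systemSol hL hq l (w l)) lam := by
  have h1 : ContinuousAt (fun l => Ring.inverse (1 - systemVolterra hL hq l)) lam := by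
    refine ContinuousAt.comp (g := Ring.inverse) (f := fun l => 1 - systemVolterra hL hq l) ?_ ?_
    · exact NormedRing.inverse_continuousAt
        (R := C(Icc 0 L, ℝ × ℝ) →L[ℝ] C(Icc 0 L, ℝ × ℝ)) (isUnit_one_sub_systemVolterra hL hq lam).unit
    · exact (continuous_const.sub (continuous_systemVolterra hL hq)).continuousAt
  have h2 : ContinuousAt (fun l => ContinuousMap.const (Icc 0 L) (w l)) lam :=
    ContinuousMap.continuous_const'.continuousAt.comp hw
  exact h1.clm_apply h2

theorem systemSol_apply (hL : 0 ≤ L) (hq : IntervalIntegrable q volume 0 L) (lam : ℝ)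
    (w : ℝ × ℝ) (x : Icc 0 L) :
    systemSol hL hq lam w x = w + systemVolterra hL hq lam (systemSol hL hq lam w) x := by
  have := DFunLike.congr_fun ((eq_systemSol_iff hL hq lam w _).1 rfl) x
  rwa [ContinuousMap.sub_apply, ContinuousMap.const_apply, sub_eq_iff_eq_add] at this

theorem systemSol_zero (hL : 0 ≤ L) (hq : IntervalIntegrable q volume 0 L) (lam : ℝ)
    (w : ℝ × ℝ) : systemSol hL hq lam w (projIcc 0 L hL 0) = w := by
  rw [systemSol_apply, systemVolterra_apply, projIcc_left]
  simp

/-- The pair `(y, y′)` given by `systemSol` is a Carathéodory solution. -/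
theorem isCaraSol_systemSol (hL : 0 ≤ L) (hq : IntervalIntegrable q volume 0 L) (lam : ℝ)
    (w : ℝ × ℝ) :
    IsCaraSol q L lam (fun t => (systemSol hL hq lam w (projIcc 0 L hL t)).1)
      (fun t => (systemSol hL hq lam w (projIcc 0 L hL t)).2) := by
  refine ⟨by fun_prop, by fun_prop, fun x hx => ?_, fun x hx => ?_⟩
  · beta_reduce
    rw [systemSol_zero, systemSol_apply, systemVolterra_apply, projIcc_of_mem hL hx]
    rfl
  · beta_reduce
    rw [systemSol_zero, systemSol_apply, systemVolterra_apply, projIcc_of_mem hL hx]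
    rfl

/-- Every Carathéodory solution is given by `systemSol`. -/
theorem IsCaraSol.eq_systemSol (hL : 0 ≤ L) (hq : IntervalIntegrable q volume 0 L) {lam : ℝ}
    {y y' : ℝ → ℝ} (h : IsCaraSol q L lam y y') :
    ∀ x ∈ Icc 0 L, (y x, y' x) = systemSol hL hq lam (y 0, y' 0) (projIcc 0 L hL x) := by
  obtain ⟨hy, hy', e, e'⟩ := h
  let u : C(Icc 0 L, ℝ × ℝ) :=
    ⟨(Icc 0 L).domRestrict fun x => (y x, y' x), (hy.prodMk hy').domRestrict⟩
  have hu : ∀ x ∈ Icc 0 L, u (projIcc 0 L hL x) = (y x, y' x) := fun x hx => by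
    rw [projIcc_of_mem hL hx]; rfl
  have hsol : u = systemSol hL hq lam (y 0, y' 0) := by
    rw [eq_systemSol_iff]
    ext1 x
    rw [ContinuousMap.sub_apply, systemVolterra_apply, ContinuousMap.const_apply,
      sub_eq_iff_eq_add]
    have hsub : uIcc 0 (x : ℝ) ⊆ Icc 0 L := by
      rw [uIcc_of_le x.2.1]; exact Icc_subset_Icc_right x.2.2
    have i1 : ∫ t in (0:ℝ)..x, (u (projIcc 0 L hL t)).2 = ∫ t in (0:ℝ)..x, y' t :=
      intervalIntegral.integral_congr fun t ht => by simp only [hu t (hsub ht)]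
    have i2 : ∫ t in (0:ℝ)..x, (q t - lam) * (u (projIcc 0 L hL t)).1 =
        ∫ t in (0:ℝ)..x, (q t - lam) * y t :=
      intervalIntegral.integral_congr fun t ht => by simp only [hu t (hsub ht)]
    rw [i1, i2, Prod.mk_add_mk, ← e x x.2, ← e' x x.2]
    rfl
  intro x hx
  rw [← hsol, hu x hx]

theorem systemSol_smul (hL : 0 ≤ L) (hq : IntervalIntegrable q volume 0 L) (lam c : ℝ)
    (w : ℝ × ℝ) : systemSol hL hq lam (c • w) = c • systemSol hL hq lam w := by
  rw [systemSol, systemSol, ← map_smul]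
  rfl

/-- Lagrange's identity. -/
theorem IsCaraSol.lagrange_identity (hL : 0 ≤ L) (hq : IntervalIntegrable q volume 0 L)
    {l₁ l₂ : ℝ} {y₁ y₁' y₂ y₂' : ℝ → ℝ} (h₁ : IsCaraSol q L l₁ y₁ y₁')
    (h₂ : IsCaraSol q L l₂ y₂ y₂') :
    y₁' L * y₂ L - y₁ L * y₂' L =
      y₁' 0 * y₂ 0 - y₁ 0 * y₂' 0 + (l₂ - l₁) * ∫ t in (0:ℝ)..L, y₁ t * y₂ t := by
  obtain ⟨c₁, c₁', e₁, e₁'⟩ := h₁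
  obtain ⟨c₂, c₂', e₂, e₂'⟩ := h₂
  rw [← uIcc_of_le hL] at c₁ c₁' c₂ c₂'
  have hq' : ∀ (l : ℝ) {y : ℝ → ℝ}, ContinuousOn y (uIcc 0 L) →
      IntervalIntegrable (fun t => (q t - l) * y t) volume 0 L := fun l y hy =>
    (hq.sub intervalIntegrable_const).mul_continuousOn hy
  have k₁ := integral_deriv_mul_add_of_primitive hL (hq' l₁ c₁) c₂'.intervalIntegrable e₁' e₂
  have k₂ := integral_deriv_mul_add_of_primitive hL c₁'.intervalIntegrable (hq' l₂ c₂) e₁ e₂'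
  have k : (∫ t in (0:ℝ)..L, ((q t - l₁) * y₁ t * y₂ t + y₁' t * y₂' t)) -
      ∫ t in (0:ℝ)..L, (y₁' t * y₂' t + y₁ t * ((q t - l₂) * y₂ t)) =
      (l₂ - l₁) * ∫ t in (0:ℝ)..L, y₁ t * y₂ t := by
    rw [← intervalIntegral.integral_sub, ← intervalIntegral.integral_const_mul]
    · congr 1
      ext t
      ring
    · exact ((hq' l₁ c₁).mul_continuousOn c₂).add (c₁'.mul c₂').intervalIntegrable
    · exact (c₁'.mul c₂').intervalIntegrable.add ((hq' l₂ c₂).continuousOn_mul c₁)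
  linarith

end InitialValueProblem

theorem RatHN.exists_hasDerivAt_eval (f : RatHN) {lam : ℝ} (h : ¬ f.IsPole lam) :
    ∃ d, 0 ≤ d ∧ HasDerivAt f.eval d lam := by
  have hne : ∀ j, f.β j - lam ≠ 0 := fun j hj => h ⟨j, sub_eq_zero.1 hj⟩
  refine ⟨f.a + ∑ j, f.γ j / (f.β j - lam) ^ 2, ?_, ?_⟩
  · exact add_nonneg f.ha (Finset.sum_nonneg fun j _ => div_nonneg (f.hγ j).le (sq_nonneg _))
  · refine HasDerivAt.add ?_ (HasDerivAt.fun_sum fun j _ => ?_)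
    · simpa using ((hasDerivAt_id lam).const_mul f.a).add_const f.c
    · have := (hasDerivAt_const lam (f.γ j)).div ((hasDerivAt_id lam).const_sub (f.β j)) (hne j)
      simpa [Pi.div_def] using this

/-- If `B x * A y - A x * B y = (y - x) * S x y` with `S x y` tending to a positive limit as
`y → x`, then `B - b * A` has exactly one zero between consecutive zeros of `A`. -/
theorem existsUnique_eq_mul_of_wronskian {A B : ℝ → ℝ} {S : ℝ → ℝ → ℝ} {s : ℝ → ℝ} {μ ν : ℝ}
    (hlt : μ < ν) (hA : ∀ x ∈ Icc μ ν, ContinuousAt A x) (hB : ∀ x ∈ Icc μ ν, ContinuousAt B x)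
    (hAμ : A μ = 0) (hAν : A ν = 0) (hne : ∀ x ∈ Ioo μ ν, A x ≠ 0)
    (hS : ∀ x ∈ Icc μ ν, ∀ y, y ≠ x → B x * A y - A x * B y = (y - x) * S x y)
    (hs : ∀ x ∈ Icc μ ν, 0 < s x) (hlim : ∀ x ∈ Icc μ ν, Tendsto (S x) (𝓝[≠] x) (𝓝 (s x)))
    (b : ℝ) : ∃! x, x ∈ Ioo μ ν ∧ B x = b * A x := by
  have hsign : ∀ x ∈ Ioo μ ν, ∀ y ∈ Ioo μ ν, 0 < A x * A y := by
    have hA' : ContinuousOn A (Ioo μ ν) := fun x hx =>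
      (hA x (Ioo_subset_Icc_self hx)).continuousWithinAt
    intro x hx y hy
    by_contra! hle
    have h0 : (0:ℝ) ∈ A '' Ioo μ ν := by
      rcases mul_nonpos_iff.1 hle with ⟨h1, h2⟩ | ⟨h1, h2⟩
      · exact isPreconnected_Ioo.intermediate_value hy hx hA' ⟨h2, h1⟩
      · exact isPreconnected_Ioo.intermediate_value hx hy hA' ⟨h1, h2⟩
    obtain ⟨z, hz, hz0⟩ := h0
    exact hne z hz hz0
  have hμmem : μ ∈ Icc μ ν := left_mem_Icc.2 hlt.le
  have hνmem : ν ∈ Icc μ ν := right_mem_Icc.2 hlt.le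
  obtain ⟨x₁, hx₁, hBx₁⟩ : ∃ x ∈ Ioo μ ν, 0 < B μ * A x := by
    have h1 : ∀ᶠ y in 𝓝[>] μ, 0 < S μ y :=
      ((hlim μ hμmem).mono_left (nhdsGT_le_nhdsNE μ)).eventually_const_lt (hs μ hμmem)
    obtain ⟨y, hy, hy'⟩ := (h1.and (Ioo_mem_nhdsGT hlt)).exists
    refine ⟨y, hy', ?_⟩
    have := hS μ hμmem y hy'.1.ne'
    rw [hAμ, zero_mul, sub_zero] at this
    rw [this]
    exact mul_pos (sub_pos.2 hy'.1) hy
  obtain ⟨x₂, hx₂, hBx₂⟩ : ∃ x ∈ Ioo μ ν, B ν * A x < 0 := by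
    have h1 : ∀ᶠ y in 𝓝[<] ν, 0 < S ν y :=
      ((hlim ν hνmem).mono_left (nhdsLT_le_nhdsNE ν)).eventually_const_lt (hs ν hνmem)
    obtain ⟨y, hy, hy'⟩ := (h1.and (Ioo_mem_nhdsLT hlt)).exists
    refine ⟨y, hy', ?_⟩
    have := hS ν hνmem y hy'.2.ne
    rw [hAν, zero_mul, sub_zero] at this
    rw [this]
    exact mul_neg_of_neg_of_pos (sub_neg.2 hy'.2) hy
  have hBneg : B μ * B ν < 0 := by
    have h1 := hsign x₁ hx₁ x₂ hx₂
    have h2 : (B μ * A x₁) * (B ν * A x₂) < 0 := mul_neg_of_pos_of_neg hBx₁ hBx₂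
    by_contra! h3
    nlinarith [mul_nonneg h3 h1.le]
  have hcont : ContinuousOn (fun x => B x - b * A x) (Icc μ ν) := fun x hx =>
    ((hB x hx).sub (continuousAt_const.mul (hA x hx))).continuousWithinAt
  obtain ⟨x₀, hx₀, hz⟩ : ∃ x ∈ Ioo μ ν, B x - b * A x = 0 := by
    rcases lt_or_ge (B μ) 0 with h | h
    · have h' : 0 < B ν := pos_of_mul_neg_right hBneg h.le
      exact intermediate_value_Ioo hlt.le hcont ⟨by simpa [hAμ] using h, by simpa [hAν] using h'⟩
    · have h' : B ν < 0 := by by_contra! h'; exact absurd (mul_nonneg h h') hBneg.not_ge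
      have h'' : 0 < B μ := h.lt_of_ne fun h0 => by simp [← h0] at hBneg
      exact intermediate_value_Ioo' hlt.le hcont ⟨by simpa [hAν] using h', by simpa [hAμ] using h''⟩
  have hderiv : ∀ x ∈ Ioo μ ν, HasDerivAt (fun x => B x / A x) (-(s x / (A x * A x))) x := by
    intro x hx
    have hx' := Ioo_subset_Icc_self hx
    rw [hasDerivAt_iff_tendsto_slope]
    have hAx : Tendsto A (𝓝[≠] x) (𝓝 (A x)) := (hA x hx').tendsto.mono_left nhdsWithin_le_nhds
    refine Tendsto.congr' ?_ (((hlim x hx').div (hAx.const_mul (A x))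
      (mul_ne_zero (hne x hx) (hne x hx))).neg)
    filter_upwards [self_mem_nhdsWithin, hAx.eventually_ne (hne x hx)] with y hy hAy
    have hyx : y - x ≠ 0 := sub_ne_zero.2 hy
    have := hS x hx' y hy
    have hAx0 := hne x hx
    have hS' : S x y = (B x * A y - A x * B y) / (y - x) := by rw [this]; field_simp
    rw [Pi.div_apply, slope_def_field, hS']
    field_simp
    ring
  have hanti : StrictAntiOn (fun x => B x / A x) (Ioo μ ν) := by
    refine strictAntiOn_of_deriv_neg (convex_Ioo μ ν)
      (fun x hx => (hderiv x hx).continuousAt.continuousWithinAt) fun x hx => ?_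
    rw [interior_Ioo] at hx
    rw [(hderiv x hx).deriv, neg_lt_zero]
    exact div_pos (hs x (Ioo_subset_Icc_self hx)) (mul_self_pos.2 (hne x hx))
  refine ⟨x₀, ⟨hx₀, sub_eq_zero.1 hz⟩, fun y ⟨hy, hyb⟩ => ?_⟩
  refine hanti.injOn hy hx₀ ?_
  simp only [hyb, sub_eq_zero.1 hz]
  rw [mul_div_cancel_right₀ _ (hne y hy), mul_div_cancel_right₀ _ (hne x₀ hx₀)]

/-- Away from the poles of `f`, an eigenvalue is detected by the solution with initial values
`(1, -f(λ))`. -/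
theorem isEigen_iff_systemSol {q : ℝ → ℝ} (hq : IntervalIntegrable q volume 0 Real.pi) (f : RatHN)
    (b : Option ℝ) {lam : ℝ} (h : ¬ f.IsPole lam) {v : ℝ × ℝ}
    (hv : systemSol Real.pi_pos.le hq lam (1, -f.eval lam) (projIcc 0 _ Real.pi_pos.le Real.pi) = v) :
    IsEigen q f b lam ↔ (∀ bb : ℝ, b = some bb → v.2 = bb * v.1) ∧ (b = none → v.1 = 0) := by
  constructor
  · rintro ⟨y, y', hsol, ⟨x, hx, hyx⟩, h1, -, h3, h4⟩
    have key : ∀ x ∈ Icc 0 Real.pi, (y x, y' x) =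
        y 0 • systemSol Real.pi_pos.le hq lam (1, -f.eval lam) (projIcc 0 _ Real.pi_pos.le x) := by
      intro x hx
      rw [hsol.eq_systemSol Real.pi_pos.le hq x hx, ← ContinuousMap.smul_apply, ← systemSol_smul,
        h1 h]
      simp [mul_comm]
    have hy0 : y 0 ≠ 0 := by
      intro h0
      have := key x hx
      rw [h0, zero_smul, Prod.mk_eq_zero] at this
      exact hyx this.1
    have hpi := key Real.pi (right_mem_Icc.2 Real.pi_pos.le)
    rw [hv, Prod.ext_iff] at hpi
    simp only [Prod.smul_fst, Prod.smul_snd, smul_eq_mul] at hpi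
    constructor
    · intro bb hb
      have := h3 bb hb
      rw [hpi.1, hpi.2] at this
      exact mul_left_cancel₀ hy0 (by linarith)
    · intro hb
      have := h4 hb
      rw [hpi.1] at this
      exact (mul_eq_zero.1 this).resolve_left hy0
  · rintro ⟨h1, h2⟩
    refine ⟨_, _, isCaraSol_systemSol Real.pi_pos.le hq lam (1, -f.eval lam),
      ⟨0, left_mem_Icc.2 Real.pi_pos.le, ?_⟩, fun _ => ?_, fun hp => absurd hp h, ?_, ?_⟩
    · rw [systemSol_zero]; exact one_ne_zero
    · simp only [systemSol_zero, mul_one]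
    · simpa only [hv] using h1
    · simpa only [hv] using h2

theorem exactly_one_eigenvalue_between
    (q : ℝ → ℝ) (hq : IntegrableOn q (Ioo 0 Real.pi))
    (f : RatHN) (μ ν : ℝ) (hlt : μ < ν)
    (hμ : IsEigen q f none μ) (hν : IsEigen q f none ν)
    (hgap : ∀ lam ∈ Ioo μ ν, ¬ IsEigen q f none lam)
    (hpole : ∀ lam ∈ Icc μ ν, ¬ f.IsPole lam)
    (b : ℝ) :
    ∃! lam : ℝ, lam ∈ Ioo μ ν ∧ IsEigen q f (some b) lam := by
  have hL := Real.pi_pos.le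
  have hq' : IntervalIntegrable q volume 0 Real.pi :=
    (intervalIntegrable_iff_integrableOn_Ioo_of_le hL).2 hq
  set U : ℝ → C(Icc 0 Real.pi, ℝ × ℝ) := fun l => systemSol hL hq' l (1, -f.eval l) with hU
  set P : ℝ → Icc 0 Real.pi := projIcc 0 Real.pi hL with hP
  have hEnone : ∀ l ∈ Icc μ ν, IsEigen q f none l ↔ (U l (P Real.pi)).1 = 0 := fun l hl => by
    rw [isEigen_iff_systemSol hq' f none (hpole l hl) rfl]
    simp [hU, hP]
  have hEsome : ∀ l ∈ Icc μ ν,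
      (IsEigen q f (some b) l ↔ (U l (P Real.pi)).2 = b * (U l (P Real.pi)).1) := fun l hl => by
    rw [isEigen_iff_systemSol hq' f (some b) (hpole l hl) rfl]
    simp [hU, hP]
  choose! d hd0 hd using fun l (hl : l ∈ Icc μ ν) => f.exists_hasDerivAt_eval (hpole l hl)
  have hUc : ∀ l ∈ Icc μ ν, ContinuousAt U l := fun l hl =>
    continuousAt_systemSol hL hq' (continuousAt_const.prodMk (hd l hl).continuousAt.neg)
  have hUpi : ∀ l ∈ Icc μ ν, ContinuousAt (fun l => U l (P Real.pi)) l := fun l hl =>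
    (continuous_eval_const (F := C(Icc 0 Real.pi, ℝ × ℝ)) (P Real.pi)).continuousAt.comp (hUc l hl)
  have hint : ∀ l, Continuous fun u : C(Icc 0 Real.pi, ℝ × ℝ) =>
      ∫ t in (0:ℝ)..Real.pi, (U l (P t)).1 * (u (P t)).1 := fun l =>
    intervalIntegral.continuous_parametric_intervalIntegral_of_continuous' (by fun_prop) _ _
  have main := existsUnique_eq_mul_of_wronskian (A := fun l => (U l (P Real.pi)).1)
    (B := fun l => (U l (P Real.pi)).2)
    (S := fun x y => slope f.eval x y + ∫ t in (0:ℝ)..Real.pi, (U x (P t)).1 * (U y (P t)).1)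
    (s := fun x => d x + ∫ t in (0:ℝ)..Real.pi, (U x (P t)).1 * (U x (P t)).1) hlt
    (fun l hl => (hUpi l hl).fst) (fun l hl => (hUpi l hl).snd)
    ((hEnone μ (left_mem_Icc.2 hlt.le)).1 hμ) ((hEnone ν (right_mem_Icc.2 hlt.le)).1 hν)
    (fun l hl h0 => hgap l hl ((hEnone l (Ioo_subset_Icc_self hl)).2 h0))
    (fun x _ y hxy => ?_) (fun x hx => ?_) (fun x hx => ?_) b
  · obtain ⟨l, ⟨hl, hl'⟩, huniq⟩ := main
    exact ⟨l, ⟨hl, (hEsome l (Ioo_subset_Icc_self hl)).2 hl'⟩, fun y ⟨hy, hy'⟩ =>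
      huniq y ⟨hy, (hEsome y (Ioo_subset_Icc_self hy)).1 hy'⟩⟩
  · have key := (isCaraSol_systemSol hL hq' x (1, -f.eval x)).lagrange_identity hL hq'
      (isCaraSol_systemSol hL hq' y (1, -f.eval y))
    simp only [systemSol_zero] at key
    refine key.trans ?_
    have : y - x ≠ 0 := sub_ne_zero.2 hxy
    rw [slope_def_field, mul_add, mul_div_cancel₀ _ this]
    ring
  · refine add_pos_of_nonneg_of_pos (hd0 x hx) ?_
    refine intervalIntegral.integral_pos Real.pi_pos (by fun_prop)
      (fun t _ => mul_self_nonneg _) ⟨0, left_mem_Icc.2 hL, ?_⟩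
    simp only [hU, hP, systemSol_zero]
    norm_num
  · refine ((hasDerivAt_iff_tendsto_slope.1 (hd x hx))).add ?_
    exact (((hint x).continuousAt.comp (hUc x hx)).tendsto).mono_left nhdsWithin_le_nhds
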